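/- Let A be a complex Banach algebra with identity and let a, b ∈ A. If a² + ab and b² + ab have gs-Drazin inverses and a²b + ab² = 0, then a + b has a generalized Hirano inverse. -/

import Mathlib

/-- `a` is quasinilpotent: `1 + a*x` is invertible for every `x` commuting with `a`. -/
def Quasinilpotent {A : Type*} [Ring A] (a : A) : Prop :=
  ∀ x : A, x * a = a * x → IsUnit (1 + a * x)

/-- `b` is a g-Drazin inverse of `a`. -/
def IsGDrazinInv {A : Type*} [Ring A] (a b : A) : Prop :=
  b = b * a * b ∧ a * b = b * a ∧ Quasinilpotent (a - a ^ 2 * b)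

/-- `b` is a gs-Drazin inverse of `a`. -/
def IsGSDrazinInv {A : Type*} [Ring A] (a b : A) : Prop :=
  b = b * a * b ∧ a * b = b * a ∧ Quasinilpotent (a - a * b)

/-- `b` is a generalized Hirano inverse of `a`. -/
def IsGenHiranoInv {A : Type*} [Ring A] (a b : A) : Prop :=
  b = b * a * b ∧ a * b = b * a ∧ Quasinilpotent (a ^ 2 - a * b)

open Filter Topology in
/-- Asymptotic form of quasinilpotence. -/
def QN {A : Type*} [NormedRing A] (m : A) : Prop :=
  ∀ ε : ℝ, 0 < ε → ∀ᶠ k : ℕ in atTop, ‖m ^ k‖ ≤ ε ^ k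

open Filter Topology in
theorem qn_of_spec {A : Type*} [NormedRing A] [NormedAlgebra ℂ A] [CompleteSpace A] (m : A)
    (h : ∀ z : ℂ, z ≠ 0 → IsUnit (algebraMap ℂ A z - m)) : QN m := by
  have h0 : spectralRadius ℂ m = 0 := by
    rw [spectralRadius]
    refine le_antisymm (iSup₂_le fun z hz => ?_) bot_le
    by_cases hz0 : z = 0
    · simp [hz0]
    · exact absurd (h z hz0) hz
  have ht := spectrum.pow_norm_pow_one_div_tendsto_nhds_spectralRadius m
  rw [h0] at ht
  intro ε hε
  have h1 := ht.eventually (gt_mem_nhds (ENNReal.ofReal_pos.mpr hε))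
  filter_upwards [h1, eventually_ge_atTop 1] with k hk hk1
  rw [ENNReal.ofReal_lt_ofReal_iff hε] at hk
  have hk' : (k : ℝ) ≠ 0 := by positivity
  have := pow_le_pow_left₀ (by positivity) hk.le k
  rwa [← Real.rpow_natCast, ← Real.rpow_mul (norm_nonneg _), one_div, inv_mul_cancel₀ hk',
    Real.rpow_one] at this

open Filter Topology in
theorem QN.mul {A : Type*} [NormedRing A] {m x : A} (h : QN m) (hc : Commute m x) :
    QN (m * x) := by
  intro ε hε
  have hp : 0 < ‖x‖ + 1 := by positivity
  filter_upwards [h (ε / (‖x‖ + 1)) (by positivity), eventually_ge_atTop 1] with k hk hk1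
  rw [hc.mul_pow]
  calc ‖m ^ k * x ^ k‖ ≤ ‖m ^ k‖ * ‖x ^ k‖ := norm_mul_le _ _
    _ ≤ (ε / (‖x‖ + 1)) ^ k * (‖x‖ + 1) ^ k := by
        gcongr
        exact (norm_pow_le' x hk1).trans (by gcongr; linarith)
    _ = ε ^ k := by rw [← mul_pow, div_mul_cancel₀ _ hp.ne']

open Filter Topology in
theorem QN.isUnit {A : Type*} [NormedRing A] [CompleteSpace A] {m : A} (h : QN m) :
    IsUnit (1 - m) := by
  obtain ⟨k, hk, hk1⟩ := ((h (1 / 2) (by norm_num)).and (eventually_ge_atTop 1)).exists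
  have h2 : ‖m ^ k‖ < 1 := hk.trans_lt (pow_lt_one₀ (by norm_num) (by norm_num) (by omega))
  have h3 := isUnit_one_sub_of_norm_lt_one h2
  rw [← mul_neg_geom_sum] at h3
  have hc : Commute (1 - m) (∑ i ∈ Finset.range k, m ^ i) := by
    rw [Commute, SemiconjBy, mul_neg_geom_sum, geom_sum_mul_neg]
  exact (hc.isUnit_mul_iff.mp h3).1

theorem QN.quasi {A : Type*} [NormedRing A] [CompleteSpace A] {m : A} (h : QN m) :
    Quasinilpotent m := by
  intro x hx
  have := (h.mul (x := -x) (Commute.neg_right hx.symm)).isUnit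
  simpa using this

open Filter Topology in
theorem QN.catalan {A : Type*} [NormedRing A] [NormedAlgebra ℂ A] [CompleteSpace A] {m : A}
    (h : QN m) :
    ∃ g : A, g = 1 + m * (g * g) ∧ ∀ y, Commute y m → Commute y g := by
  have hs : Summable (fun k => ‖(_root_.catalan k : A) * m ^ k‖) := by
    refine Summable.of_norm_bounded_eventually_nat (g := fun k => ‖(1 : A)‖ * (1 / 2 : ℝ) ^ k)
      (summable_geometric_two.mul_left _) ?_
    filter_upwards [h (1 / 8) (by norm_num)] with k hk
    have hcat : _root_.catalan k ≤ 4 ^ k := by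
      refine le_trans ?_ (Nat.centralBinom_le_four_pow k)
      rw [← succ_mul_catalan_eq_centralBinom]
      exact Nat.le_mul_of_pos_left _ (Nat.succ_pos _)
    have hcat' : (_root_.catalan k : ℝ) ≤ 4 ^ k := by exact_mod_cast hcat
    rw [norm_norm]
    calc ‖(_root_.catalan k : A) * m ^ k‖ ≤ ‖(_root_.catalan k : A)‖ * ‖m ^ k‖ := norm_mul_le _ _
      _ ≤ ((4 : ℝ) ^ k * ‖(1 : A)‖) * (1 / 8) ^ k := by
          gcongr
          rw [← nsmul_one]
          exact (norm_nsmul_le).trans (by gcongr)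
      _ = ‖(1 : A)‖ * (1 / 2 : ℝ) ^ k := by
          rw [mul_comm ((4 : ℝ) ^ k), mul_assoc, ← mul_pow]; norm_num
  refine ⟨∑' k, (_root_.catalan k : A) * m ^ k, ?_, ?_⟩
  · rw [tsum_mul_tsum_eq_tsum_sum_antidiagonal_of_summable_norm hs hs,
      ← (summable_norm_sum_mul_antidiagonal_of_summable_norm hs hs).of_norm.tsum_mul_left m]
    conv_lhs => rw [hs.of_norm.tsum_eq_zero_add]
    congr 1
    · simp
    · refine tsum_congr fun n => ?_
      rw [catalan_succ', Nat.cast_sum, Finset.sum_mul, Finset.mul_sum]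
      refine Finset.sum_congr rfl fun ij hij => ?_
      rw [← Finset.HasAntidiagonal.mem_antidiagonal.mp hij, pow_succ', pow_add, Nat.cast_mul]
      have e1 := (Nat.cast_commute (_root_.catalan ij.1) m).eq
      have e2 := (Nat.cast_commute (_root_.catalan ij.2) (m * m ^ ij.1)).eq
      generalize (_root_.catalan ij.1 : A) = C at *
      generalize (_root_.catalan ij.2 : A) = D at *
      calc C * D * (m * (m ^ ij.1 * m ^ ij.2)) = C * (D * (m * m ^ ij.1)) * m ^ ij.2 := by
            simp only [mul_assoc]
        _ = C * m * (m ^ ij.1 * D * m ^ ij.2) := by rw [e2]; simp only [mul_assoc]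
        _ = _ := by rw [e1]; simp only [mul_assoc]
  · intro y hy
    exact Commute.tsum_right _ fun k => (Nat.commute_cast y _).mul_right (hy.pow_right k)

theorem exists_idem_of_qn {A : Type*} [NormedRing A] [NormedAlgebra ℂ A] [CompleteSpace A] (w : A)
    (h : QN (w - w ^ 2)) :
    ∃ e : A, e * e = e ∧ QN (w - e) ∧ ∀ y, Commute y w → Commute y e := by
  obtain ⟨g, hg, hgc⟩ := h.catalan
  set m := w - w ^ 2 with hm
  have hym : ∀ y, Commute y w → Commute y m := fun y hy => hy.sub_right (hy.pow_right 2)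
  have hmg : Commute m g := hgc m (Commute.refl m)
  have hqf : QN (m * g) := h.mul hmg
  set f := m * g with hf
  have hff : f = m + f * f := by
    have : f * f = m * (m * (g * g)) := by
      rw [hf]
      calc m * g * (m * g) = m * (g * m) * g := by noncomm_ring
        _ = _ := by rw [← hmg.eq]; noncomm_ring
    rw [this]
    calc f = m * (1 + m * (g * g)) := by rw [← hg]
      _ = _ := by noncomm_ring
  have hyf : ∀ y, Commute y w → Commute y f := fun y hy =>
    (hym y hy).mul_right (hgc y (hym y hy))
  have hwf := hyf w (Commute.refl w)
  have hu : IsUnit (1 - f * 2) := (hqf.mul (Commute.ofNat_right f 2)).isUnit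
  obtain ⟨u, hu⟩ := hu
  have hyU : ∀ y, Commute y w → Commute y (u : A) := fun y hy => by
    rw [hu]; exact (Commute.one_right y).sub_right ((hyf y hy).mul_right (Commute.ofNat_right y 2))
  have hyu : ∀ y, Commute y w → Commute y (↑u⁻¹ : A) := fun y hy => (hyU y hy).units_inv_right
  have hcwf : Commute (w - f) w := (Commute.refl w).sub_left hwf.symm
  have hsq : (w - f) * (w - f) = (w - f) * u := by
    have h1 : w - w * w = f - f * f := by
      rw [eq_sub_iff_add_eq, ← sq, ← hm]; exact hff.symm
    have h2 := hwf.eq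
    rw [hu]
    have : (w - f) * (w - f) - (w - f) * (1 - f * 2) =
      -(w - w * w) + (f - f * f) + (w * f - f * w) := by noncomm_ring
    rw [← sub_eq_zero, this, h1, h2]; simp
  refine ⟨(w - f) * ↑u⁻¹, ?_, ?_, fun y hy => (hy.sub_right (hyf y hy)).mul_right (hyu y hy)⟩
  · have hc := (hyu _ hcwf).eq
    calc (w - f) * ↑u⁻¹ * ((w - f) * ↑u⁻¹) = (w - f) * (↑u⁻¹ * (w - f)) * ↑u⁻¹ := by
          simp only [mul_assoc]
      _ = (w - f) * (w - f) * ↑u⁻¹ * ↑u⁻¹ := by rw [← hc]; simp only [mul_assoc]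
      _ = _ := by rw [hsq]; simp [mul_assoc]
  · have hw : w - (w - f) * ↑u⁻¹ = f * ((1 - 2 * w) * ↑u⁻¹) := by
      rw [← mul_assoc, Units.eq_mul_inv_iff_mul_eq, sub_mul, Units.inv_mul_cancel_right, hu]
      have h2 := hwf.eq
      have : w * (1 - f * 2) - (w - f) = f - 2 * (w * f) := by noncomm_ring
      rw [this, h2]; noncomm_ring
    rw [hw]
    refine hqf.mul ?_
    have hfw : Commute f w := hwf.symm
    exact ((Commute.one_right f).sub_right ((Commute.ofNat_right f 2).mul_right hfw)).mul_right
      (hyu f hfw)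

theorem gs_spec {A : Type*} [NormedRing A] [NormedAlgebra ℂ A] (a : A)
    (h : ∃ x, IsGSDrazinInv a x) (z : ℂ) (hz0 : z ≠ 0) (hz1 : z ≠ 1) :
    IsUnit (algebraMap ℂ A z - a) := by
  obtain ⟨x, hx1, hx2, hx3⟩ := h
  obtain ⟨p, hp⟩ : ∃ p, p = a * x := ⟨_, rfl⟩
  have hpp : p * p = p := by
    rw [hp]
    calc a * x * (a * x) = a * (x * a * x) := by noncomm_ring
      _ = _ := by rw [← hx1]
  have hap : Commute p a := by
    show p * a = a * p
    rw [hp, mul_assoc, hx2]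
  rw [← hp] at hx3
  have hz1' : z - 1 ≠ 0 := sub_ne_zero.mpr hz1
  let v : A := z⁻¹ • (1 - p) + (z - 1)⁻¹ • p
  have hpv : ∀ y, Commute p y → Commute v y := fun y hy =>
    (((Commute.one_left y).sub_left hy).smul_left _).add_left (hy.smul_left _)
  have hv1 : (algebraMap ℂ A z - p) * v = 1 := by
    have : algebraMap ℂ A z - p = z • (1 - p) + (z - 1) • p := by
      rw [Algebra.algebraMap_eq_smul_one]; module
    have e1 : (1 - p) * p = 0 := by rw [sub_mul, hpp]; simp
    have e2 : p * (1 - p) = 0 := by rw [mul_sub, hpp]; simp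
    have e3 : (1 - p) * (1 - p) = 1 - p := by rw [sub_mul, e2]; simp
    rw [this]
    simp only [v, add_mul, mul_add, smul_mul_assoc, mul_smul_comm, e1, e2, e3, hpp, smul_zero]
    simp [smul_smul, hz0, hz1']
  have hpz : Commute v (algebraMap ℂ A z - p) :=
    hpv _ ((Algebra.commute_algebraMap_right z p).sub_right (Commute.refl p))
  have hv2 : v * (algebraMap ℂ A z - p) = 1 := by rw [hpz.eq, hv1]
  have hq := hpv (a - p) (hap.sub_right (Commute.refl p))
  have h1 := hx3 (-v) (by simp [hq.eq])
  have h2 : IsUnit (algebraMap ℂ A z - p) := ⟨⟨_, v, hv1, hv2⟩, rfl⟩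
  have h3 := h1.mul h2
  convert h3 using 1
  rw [add_mul, mul_assoc, neg_mul, hv2]
  noncomm_ring

theorem stmt17 {A : Type*} [NormedRing A] [NormedAlgebra ℂ A] [CompleteSpace A] (a b : A)
    (h1 : ∃ x, IsGSDrazinInv (a ^ 2 + a * b) x)
    (h2 : ∃ x, IsGSDrazinInv (b ^ 2 + a * b) x)
    (h3 : a ^ 2 * b + a * b ^ 2 = 0) :
    ∃ x, IsGenHiranoInv (a + b) x := by
  obtain ⟨c, hc⟩ : ∃ c, c = a + b := ⟨_, rfl⟩
  have e1 : a ^ 2 + a * b = a * c := by rw [hc]; noncomm_ring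
  have e2 : b ^ 2 + a * b = c * b := by rw [hc]; noncomm_ring
  have e3 : a * c * b = 0 := by rw [← h3, hc]; noncomm_ring
  rw [e1] at h1
  rw [e2] at h2
  rw [← hc]
  have hs : ∀ z : ℂ, z ≠ 0 → z ≠ 1 → IsUnit (algebraMap ℂ A z - c ^ 2) := by
    intro z hz0 hz1
    have u1 : IsUnit (algebraMap ℂ A z - c * a) := by
      have := gs_spec _ h1 z hz0 hz1
      by_contra hcon
      have h4 : z ∈ spectrum ℂ (c * a) := hcon
      have h5 : z ∈ spectrum ℂ (a * c) :=
        (spectrum.unit_mem_mul_comm (r := Units.mk0 z hz0)).mp h4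
      exact h5 this
    have u2 := gs_spec _ h2 z hz0 hz1
    have u3 := u1.mul u2
    have u4 : IsUnit (algebraMap ℂ A z⁻¹) := (IsUnit.mk0 _ (inv_ne_zero hz0)).map _
    have := u4.mul u3
    convert this using 1
    have e4 : (algebraMap ℂ A z - c * a) * (algebraMap ℂ A z - c * b)
        = algebraMap ℂ A z * (algebraMap ℂ A z - c ^ 2) := by
      have hcc : c ^ 2 = c * a + c * b := by rw [← mul_add, ← hc, sq]
      have hz := (Algebra.commutes z (c * a) : algebraMap ℂ A z * (c * a) = _)
      have h6 : c * a * (c * b) = 0 := by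
        calc c * a * (c * b) = c * (a * c * b) := by noncomm_ring
          _ = 0 := by rw [e3, mul_zero]
      rw [hcc, sub_mul, mul_sub, mul_sub, h6, ← hz]; noncomm_ring
    rw [e4, ← mul_assoc, ← map_mul, inv_mul_cancel₀ hz0, map_one, one_mul]
  have hq : QN (c ^ 2 - (c ^ 2) ^ 2) := by
    apply qn_of_spec
    intro z hz
    obtain ⟨s, hs2⟩ := IsAlgClosed.exists_pow_nat_eq (1 - 4 * z) (n := 2) (by norm_num)
    have k1 : (1 + s) / 2 * ((1 - s) / 2) = z := by linear_combination -hs2 / 4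
    have a0 : (1 + s) / 2 ≠ 0 := fun h => hz (by rw [← k1, h, zero_mul])
    have b0 : (1 - s) / 2 ≠ 0 := fun h => hz (by rw [← k1, h, mul_zero])
    have a1 : (1 + s) / 2 ≠ 1 := fun h => b0 (by linear_combination -h)
    have b1 : (1 - s) / 2 ≠ 1 := fun h => a0 (by linear_combination -h)
    have := (hs _ a0 a1).mul (hs _ b0 b1)
    convert this using 1
    have k2 : algebraMap ℂ A ((1 + s) / 2) + algebraMap ℂ A ((1 - s) / 2) = 1 := by
      rw [← map_add, ← map_one (algebraMap ℂ A)]; congr 1; ring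
    have k3 := (Algebra.commutes ((1 - s) / 2) (c ^ 2) : _ = c ^ 2 * algebraMap ℂ A ((1 - s) / 2))
    rw [sub_mul, mul_sub, mul_sub, ← map_mul, k1, ← k3]
    have k4 : c ^ 2 = algebraMap ℂ A ((1 + s) / 2) * c ^ 2 +
        algebraMap ℂ A ((1 - s) / 2) * c ^ 2 := by rw [← add_mul, k2, one_mul]
    nth_rewrite 1 [k4]
    noncomm_ring
  obtain ⟨e, hee, heq, hec⟩ := exists_idem_of_qn _ hq
  have hce : Commute c e := hec c ((Commute.refl c).pow_right 2)
  obtain ⟨q, hqd⟩ : ∃ q, q = c ^ 2 - e := ⟨_, rfl⟩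
  rw [← hqd] at heq
  have hu : IsUnit (1 + q) := by simpa using heq.quasi 1 (by simp)
  obtain ⟨u, hu⟩ := hu
  have hyu : ∀ y, Commute y c → Commute y e → Commute y (↑u⁻¹ : A) := fun y hy hye => by
    apply Commute.units_inv_right
    rw [hu, hqd]
    exact (Commute.one_right y).add_right ((hy.pow_right 2).sub_right hye)
  have hcu := hyu c (Commute.refl c) hce
  have heu := hyu e hce.symm (Commute.refl e)
  have hcb : c * (c * (e * ↑u⁻¹)) = e := by
    have h4 : c * (c * e) = e * u := by
      rw [hu, hqd, mul_add, mul_sub, hee, ← mul_assoc, ← sq, (hce.pow_left 2).eq]; noncomm_ring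
    calc c * (c * (e * ↑u⁻¹)) = c * (c * e) * ↑u⁻¹ := by noncomm_ring
      _ = e := by rw [h4]; simp [mul_assoc]
  have hcom : Commute c (c * (e * ↑u⁻¹)) := (Commute.refl c).mul_right (hce.mul_right hcu)
  refine ⟨c * (e * ↑u⁻¹), ?_, hcom.eq, ?_⟩
  · rw [← hcom.eq, hcb, ← mul_assoc e c, ← hce.eq, mul_assoc c e, ← mul_assoc e e, hee]
  · rw [hcb, ← hqd]; exact heq.quasi
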